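/- arXiv:2301.00273 — 8 statements merged into one kernel-verified Lean document; each statement's English description precedes it below -/
import Mathlib

section
/- Fix finite nonempty sets A_1,…,A_n ⊆ ℝ^n and ε > 0. For each positive integer m consider the random fewnomial system with the stretched supports mA_1,…,mA_n (that is, F_{mA_i,c_i} with all coefficients c_i(a), a ∈ mA_i, independent standard Gaussian). Then the probability that this system has a common zero w ∈ ℝ^n with ‖w‖ > ε tends to 0 as m → ∞. -/
open MeasureTheory ProbabilityTheory Pointwise
open scoped ENNReal RealInnerProductSpace

noncomputable section

/-- `F_{A,c}(w) = ∑_{a ∈ A} c(a) · exp⟨a,w⟩`. -/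
def Fexp {n : ℕ} (A : Finset (EuclideanSpace ℝ (Fin n))) (c : A → ℝ)
    (w : EuclideanSpace ℝ (Fin n)) : ℝ :=
  ∑ a : A, c a * Real.exp ⟪(a : EuclideanSpace ℝ (Fin n)), w⟫

/-- The fewnomial system `(F_{A_1,c_1},…,F_{A_n,c_n})` as a map `ℝ^n → ℝ^n`. -/
def sysF {n : ℕ} (A : Fin n → Finset (EuclideanSpace ℝ (Fin n)))
    (c : ∀ i, A i → ℝ) (w : EuclideanSpace ℝ (Fin n)) : Fin n → ℝ :=
  fun i => Fexp (A i) (c i) w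

/-- The set of nondegenerate common zeros of the system: the Jacobian
(i.e. the derivative) at the zero is invertible. -/
def nondegZeros {n : ℕ} (A : Fin n → Finset (EuclideanSpace ℝ (Fin n)))
    (c : ∀ i, A i → ℝ) : Set (EuclideanSpace ℝ (Fin n)) :=
  {w | sysF A c w = 0 ∧ Function.Bijective (fderiv ℝ (sysF A c) w)}

/-- Independent standard Gaussian coefficients `c_i(a)`, `i = 1,…,n`, `a ∈ A_i`. -/
def coeffMeasure {n : ℕ} (A : Fin n → Finset (EuclideanSpace ℝ (Fin n))) :
    Measure (∀ i, A i → ℝ) :=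
  Measure.pi fun _ => Measure.pi fun _ => gaussianReal 0 1

/-- `E(A_1,…,A_n)`: the expected number of nondegenerate common zeros. -/
def EE {n : ℕ} (A : Fin n → Finset (EuclideanSpace ℝ (Fin n))) : ℝ≥0∞ :=
  ∫⁻ c, ((nondegZeros A c).encard : ℝ≥0∞) ∂(coeffMeasure A)

open Classical in
/-- The stretched support `m·A = {m·a : a ∈ A}`. -/
def stretch {n : ℕ} (m : ℕ) (A : Finset (EuclideanSpace ℝ (Fin n))) :
    Finset (EuclideanSpace ℝ (Fin n)) :=
  A.image fun a => (m : ℝ) • a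

lemma gaussianReal_le_volume : gaussianReal 0 1 ≤ (volume : Measure ℝ) := by
  rw [gaussianReal_of_var_ne_zero 0 one_ne_zero]
  refine (withDensity_mono (ae_of_all _ fun x => ?_)).trans_eq withDensity_one
  rw [gaussianPDF, Pi.one_apply, ENNReal.ofReal_le_one, gaussianPDFReal]
  refine mul_le_one₀ (inv_le_one_of_one_le₀ (Real.one_le_sqrt.2 ?_)) (Real.exp_pos _).le
    (Real.exp_le_one_iff.2 ?_)
  · have := Real.pi_gt_three
    simp only [NNReal.coe_one]
    linarith
  · exact div_nonpos_of_nonpos_of_nonneg (neg_nonpos.2 (sq_nonneg _)) (by positivity)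

lemma measure_pi_mono {ι : Type*} [Fintype ι] {α : ι → Type*} [∀ i, MeasurableSpace (α i)]
    {μ ν : ∀ i, Measure (α i)} [∀ i, SigmaFinite (μ i)] (h : ∀ i, μ i ≤ ν i) :
    Measure.pi μ ≤ Measure.pi ν := by
  refine Measure.le_iff.2 fun s hs => ?_
  have key : (Measure.pi μ).toOuterMeasure ≤ OuterMeasure.pi fun i => (ν i).toOuterMeasure :=
    OuterMeasure.le_pi.2 fun t _ => (Measure.pi_pi μ t).trans_le
      (Finset.prod_le_prod' fun i _ => h i (t i))
  refine (key s).trans_eq ?_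
  rw [Measure.pi, toMeasure_apply _ _ hs]

lemma coeffMeasure_le_volume {n : ℕ} (A : Fin n → Finset (EuclideanSpace ℝ (Fin n))) :
    coeffMeasure A ≤ volume :=
  measure_pi_mono fun _ => measure_pi_mono fun _ => gaussianReal_le_volume

instance isProbabilityMeasure_coeffMeasure {n : ℕ}
    (A : Fin n → Finset (EuclideanSpace ℝ (Fin n))) : IsProbabilityMeasure (coeffMeasure A) := by
  unfold coeffMeasure
  infer_instance

/-- A map from a finite-dimensional space to itself that is constant along a fixed nonzero
direction has a negligible range. -/
lemma volume_range_eq_zero_of_invariant {E : Type*} [NormedAddCommGroup E] [NormedSpace ℝ E]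
    [FiniteDimensional ℝ E] [MeasurableSpace E] [BorelSpace E] (μ : Measure E) [μ.IsAddHaarMeasure]
    {G : E → E} (hG : Differentiable ℝ G) {u : E} (hu : u ≠ 0)
    (hinv : ∀ c (t : ℝ), G (c + t • u) = G c) : μ (Set.range G) = 0 := by
  rw [← Set.image_univ]
  refine addHaar_image_eq_zero_of_det_fderivWithin_eq_zero μ (f' := fderiv ℝ G)
    (fun c _ => (hG c).hasFDerivAt.hasFDerivWithinAt) fun c _ => ?_
  have h0 : fderiv ℝ G c u = 0 := by
    rw [← (hG c).lineDeriv_eq_fderiv]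
    simp [lineDeriv, hinv]
  refine LinearMap.det_eq_zero_iff_ker_ne_bot.2 fun h => hu ?_
  have : u ∈ LinearMap.ker (fderiv ℝ G c : E →ₗ[ℝ] E) := h0
  rwa [h, Submodule.mem_bot] at this

open Classical in
/-- A random system whose supports are all orthogonal, up to translation, to a common nonzero
vector has almost surely no zero. -/
lemma coeffMeasure_degenerate_eq_zero {n : ℕ} (A : Fin n → Finset (EuclideanSpace ℝ (Fin n)))
    (b : ∀ i, A i) (B : ∀ i, Finset (A i)) (hb : ∀ i, b i ∈ B i)
    {v : EuclideanSpace ℝ (Fin n)} (hv : v ≠ 0)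
    (hB : ∀ i, ∀ a ∈ B i, ⟪(a : EuclideanSpace ℝ (Fin n)) - b i, v⟫ = 0) :
    coeffMeasure A {c | ∃ w : EuclideanSpace ℝ (Fin n), ∀ i,
      ∑ a ∈ B i, c i a * Real.exp ⟪(a : EuclideanSpace ℝ (Fin n)) - b i, w⟫ = 0} = 0 := by
  refine le_antisymm ((coeffMeasure_le_volume A _).trans ?_) zero_le
  let W : (∀ i, A i → ℝ) → EuclideanSpace ℝ (Fin n) := fun c => WithLp.toLp 2 fun i => c i (b i)
  let G : (∀ i, A i → ℝ) → ∀ i, A i → ℝ := fun c i a =>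
    if a = b i then -∑ a' ∈ (B i).erase (b i), c i a' *
      Real.exp ⟪(a' : EuclideanSpace ℝ (Fin n)) - b i, W c⟫ else c i a
  let u : ∀ i, A i → ℝ := fun i a => if a = b i then v i else 0
  have hW : Differentiable ℝ W := by
    refine (differentiable_euclidean (f := W)).2 fun i => ?_
    simp only [W]
    fun_prop
  have hG : Differentiable ℝ G := by
    refine differentiable_pi.2 fun i => differentiable_pi.2 fun a => ?_
    by_cases h : a = b i
    · simp only [G, if_pos h]
      have h1 : ∀ x : EuclideanSpace ℝ (Fin n), Differentiable ℝ fun c => ⟪x, W c⟫ :=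
        fun x => (differentiable_const x).inner ℝ hW
      refine Differentiable.neg (Differentiable.fun_sum fun a' _ =>
        Differentiable.mul (by fun_prop) (h1 _).exp)
    · simp only [G, if_neg h]
      fun_prop
  have hu : u ≠ 0 := by
    intro h
    refine hv (PiLp.ext fun i => ?_)
    simpa [u] using congr_fun (congr_fun h i) (b i)
  have hinv : ∀ c (t : ℝ), G (c + t • u) = G c := by
    intro c t
    have hWu : W (c + t • u) = W c + t • v := by
      refine PiLp.ext fun i => ?_
      simp [W, u]
    funext i a
    by_cases h : a = b i
    · simp only [G, if_pos h]
      refine congr_arg Neg.neg (Finset.sum_congr rfl fun a' ha' => ?_)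
      rw [Finset.mem_erase] at ha'
      rw [hWu, inner_add_right, inner_smul_right, hB i a' ha'.2]
      simp [u, ha'.1]
    · simp [G, h, u]
  refine (measure_mono ?_).trans (volume_range_eq_zero_of_invariant volume hG hu hinv).le
  rintro c ⟨w, hw⟩
  refine ⟨fun i a => if a = b i then w i else c i a, ?_⟩
  have hWw : W (fun i a => if a = b i then w i else c i a) = w := by
    refine PiLp.ext fun i => ?_
    simp [W]
  funext i a
  by_cases h : a = b i
  · subst h
    simp only [G, if_pos, hWw]
    have := hw i
    rw [← Finset.add_sum_erase _ _ (hb i), sub_self, inner_zero_left, Real.exp_zero,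
      mul_one] at this
    rw [neg_eq_iff_add_eq_zero, add_comm, ← this]
    refine congr_arg _ (Finset.sum_congr rfl fun a' ha' => ?_)
    rw [if_neg (Finset.ne_of_mem_erase ha')]
  · simp [G, h]

/-- If a system has arbitrarily large zeros, then a subsystem supported on faces that are all
orthogonal, up to translation, to a common nonzero vector has a zero. -/
lemma exists_degenerate_zero {n : ℕ} (A : Fin n → Finset (EuclideanSpace ℝ (Fin n)))
    (hA : ∀ i, (A i).Nonempty) (c : ∀ i, A i → ℝ)
    (hZ : ∀ R : ℝ, ∃ w : EuclideanSpace ℝ (Fin n), R ≤ ‖w‖ ∧ ∀ i, Fexp (A i) (c i) w = 0) :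
    ∃ (b : ∀ i, A i) (B : ∀ i, Finset (A i)), (∀ i, b i ∈ B i) ∧
      (∃ v : EuclideanSpace ℝ (Fin n), v ≠ 0 ∧
        ∀ i, ∀ a ∈ B i, ⟪(a : EuclideanSpace ℝ (Fin n)) - b i, v⟫ = 0) ∧
      ∃ w : EuclideanSpace ℝ (Fin n), ∀ i,
        ∑ a ∈ B i, c i a * Real.exp ⟪(a : EuclideanSpace ℝ (Fin n)) - b i, w⟫ = 0 := by
  classical
  have := fun i => (hA i).to_subtype
  choose z hz hz0 using fun k : ℕ => hZ k
  -- an ultrafilter along which the zeros escape to infinity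
  let f : Ultrafilter ℕ := Ultrafilter.of Filter.atTop
  have hf : (f : Filter ℕ) ≤ Filter.atTop := Ultrafilter.of_le _
  have hnorm : Filter.Tendsto (fun k => ‖z k‖) f Filter.atTop :=
    (Filter.tendsto_atTop_mono hz tendsto_natCast_atTop_atTop).mono_left hf
  have hmax : ∀ i, ∃ b : A i, ∀ᶠ k in (f : Filter ℕ), ∀ a : A i,
      ⟪(a : EuclideanSpace ℝ (Fin n)) - b, z k⟫ ≤ 0 := by
    intro i
    refine Ultrafilter.eventually_exists_iff.1 (Filter.Eventually.of_forall fun k => ?_)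
    obtain ⟨b, hb⟩ := Finite.exists_max fun a : A i => ⟪(a : EuclideanSpace ℝ (Fin n)), z k⟫
    exact ⟨b, fun a => by simpa [inner_sub_left] using hb a⟩
  choose b hb using hmax
  have hlim : ∀ i (a : A i), ∃ x : ℝ, 0 ≤ x ∧ Filter.Tendsto
      (fun k => Real.exp ⟪(a : EuclideanSpace ℝ (Fin n)) - b i, z k⟫) f (nhds x) := by
    intro i a
    obtain ⟨x, hx, hxl⟩ := (isCompact_Icc (a := (0 : ℝ)) (b := 1)).ultrafilter_le_nhds
      (f.map fun k => Real.exp ⟪(a : EuclideanSpace ℝ (Fin n)) - b i, z k⟫)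
      (Filter.le_principal_iff.2 ((hb i).mono fun k hk =>
        ⟨(Real.exp_pos _).le, Real.exp_le_one_iff.2 (hk a)⟩))
    exact ⟨x, hx.1, hxl⟩
  choose x hx0 hx using hlim
  let B : ∀ i, Finset (A i) := fun i => Finset.univ.filter fun a => 0 < x i a
  have hbx : ∀ i, x i (b i) = 1 := fun i =>
    tendsto_nhds_unique (hx i (b i)) (by simp)
  let L : EuclideanSpace ℝ (Fin n) →ₗ[ℝ] (∀ i, B i → ℝ) :=
    LinearMap.pi fun i => LinearMap.pi fun a =>
      innerₛₗ ℝ ((a.1 : EuclideanSpace ℝ (Fin n)) - b i)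
  have hL : Filter.Tendsto (fun k => L (z k)) f (nhds fun i a => Real.log (x i a)) := by
    refine tendsto_pi_nhds.2 fun i => tendsto_pi_nhds.2 fun a => ?_
    have hpos : 0 < x i a := (Finset.mem_filter.1 a.2).2
    simpa [L, inner_sub_left] using (hx i a).log hpos.ne'
  refine ⟨b, B, fun i => by simp [B, hbx], ?_, ?_⟩
  · by_contra! hcon
    have hker : LinearMap.ker L = ⊥ := by
      refine LinearMap.ker_eq_bot'.2 fun v hv => ?_
      by_contra hv0
      obtain ⟨i, a, ha, hne⟩ := hcon v hv0
      exact hne (congr_fun (congr_fun hv i) ⟨a, ha⟩)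
    obtain ⟨K, _, hK⟩ := L.exists_antilipschitzWith hker
    refine not_tendsto_nhds_of_tendsto_atTop
      (Filter.tendsto_atTop_mono (fun k => ?_) hnorm) _ (hL.norm.const_mul (K : ℝ))
    simpa using hK.le_mul_dist (z k) 0
  · obtain ⟨w, hw⟩ : (fun i (a : B i) => Real.log (x i a)) ∈ LinearMap.range L :=
      (Submodule.closed_of_finiteDimensional (LinearMap.range L)).mem_of_tendsto hL
        (Filter.Eventually.of_forall fun k => LinearMap.mem_range_self L (z k))
    have hwx : ∀ i, ∀ a ∈ B i,
        Real.exp ⟪(a : EuclideanSpace ℝ (Fin n)) - b i, w⟫ = x i a := by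
      intro i a ha
      have h1 : ⟪(a : EuclideanSpace ℝ (Fin n)) - b i, w⟫ = Real.log (x i a) :=
        congr_fun (congr_fun hw i) ⟨a, ha⟩
      rw [h1, Real.exp_log (Finset.mem_filter.1 ha).2]
    refine ⟨w, fun i => ?_⟩
    rw [Finset.sum_congr rfl fun a ha => by rw [hwx i a ha],
      Finset.sum_subset (Finset.subset_univ _) fun a _ ha => ?_]
    · have hsum : Filter.Tendsto (fun k => ∑ a : A i, c i a *
          Real.exp ⟪(a : EuclideanSpace ℝ (Fin n)) - b i, z k⟫) f
          (nhds (∑ a : A i, c i a * x i a)) :=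
        tendsto_finsetSum _ fun a _ => (hx i a).const_mul _
      refine tendsto_nhds_unique hsum (tendsto_const_nhds.congr fun k => ?_)
      have h0 := hz0 k i
      rw [Fexp] at h0
      simp_rw [inner_sub_left, Real.exp_sub, mul_div_assoc', ← Finset.sum_div]
      rw [h0, zero_div]
    · have : x i a = 0 := le_antisymm (by simpa [B] using ha) (hx0 i a)
      rw [this, mul_zero]

lemma measurableSet_exists_large_zero {n : ℕ} (A : Fin n → Finset (EuclideanSpace ℝ (Fin n)))
    (R : ℝ) : MeasurableSet {c : ∀ i, A i → ℝ | ∃ w : EuclideanSpace ℝ (Fin n), R ≤ ‖w‖ ∧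
      ∀ i, Fexp (A i) (c i) w = 0} := by
  let S : Set ((∀ i, A i → ℝ) × EuclideanSpace ℝ (Fin n)) :=
    {p | R ≤ ‖p.2‖ ∧ ∀ i, Fexp (A i) (p.1 i) p.2 = 0}
  have hS : IsClosed S := by
    simp only [S, Fexp, Set.ofPred_and, Set.ofPred_forall]
    exact (isClosed_le (by fun_prop) (by fun_prop)).inter
      (isClosed_iInter fun i => isClosed_eq (by fun_prop) (by fun_prop))
  obtain ⟨K, hK, hKS⟩ := (isSigmaCompact_univ.of_isClosed_subset hS (Set.subset_univ _)).image
    continuous_fst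
  convert MeasurableSet.iUnion fun k => (hK k).measurableSet
  rw [hKS]
  ext c
  simp [S]

lemma tendsto_coeffMeasure_exists_large_zero {n : ℕ}
    (A : Fin n → Finset (EuclideanSpace ℝ (Fin n))) (hA : ∀ i, (A i).Nonempty)
    {ε : ℝ} (hε : 0 < ε) :
    Filter.Tendsto (fun m : ℕ => coeffMeasure A {c | ∃ w : EuclideanSpace ℝ (Fin n),
      m * ε ≤ ‖w‖ ∧ ∀ i, Fexp (A i) (c i) w = 0}) Filter.atTop (nhds 0) := by
  have h := tendsto_measure_iInter_atTop (μ := coeffMeasure A)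
    (fun m : ℕ => (measurableSet_exists_large_zero A (m * ε)).nullMeasurableSet)
    (fun m k hmk c ⟨w, hw, hw0⟩ => ⟨w, le_trans (by gcongr) hw, hw0⟩)
    ⟨0, measure_ne_top _ _⟩
  suffices h0 : coeffMeasure A (⋂ m : ℕ, {c | ∃ w : EuclideanSpace ℝ (Fin n),
      m * ε ≤ ‖w‖ ∧ ∀ i, Fexp (A i) (c i) w = 0}) = 0 by
    rwa [h0] at h
  refine measure_mono_null (μ := coeffMeasure A) (t := ⋃ (b : ∀ i, A i) (B : ∀ i, Finset (A i))
    (_ : (∀ i, b i ∈ B i) ∧ ∃ v : EuclideanSpace ℝ (Fin n), v ≠ 0 ∧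
      ∀ i, ∀ a ∈ B i, ⟪(a : EuclideanSpace ℝ (Fin n)) - b i, v⟫ = 0),
    {c : ∀ i, A i → ℝ | ∃ w : EuclideanSpace ℝ (Fin n), ∀ i, ∑ a ∈ B i, c i a *
      Real.exp ⟪(a : EuclideanSpace ℝ (Fin n)) - b i, w⟫ = 0}) (fun c hc => ?_) ?_
  · obtain ⟨b, B, hb, hv, hw⟩ := exists_degenerate_zero A hA c fun R => by
      obtain ⟨m, hm⟩ := exists_nat_ge (R / ε)
      obtain ⟨w, hw, hw0⟩ := Set.mem_iInter.1 hc m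
      exact ⟨w, ((div_le_iff₀ hε).1 hm).trans hw, hw0⟩
    simp only [Set.mem_iUnion]
    exact ⟨b, B, ⟨hb, hv⟩, hw⟩
  · refine measure_iUnion_null fun b => measure_iUnion_null fun B => measure_iUnion_null ?_
    rintro ⟨hb, v, hv, hB⟩
    exact coeffMeasure_degenerate_eq_zero A b B hb hv hB

/-- Stretching as a bijection of supports. -/
def stretchEquiv {n m : ℕ} (hm : m ≠ 0) (A : Finset (EuclideanSpace ℝ (Fin n))) :
    A ≃ stretch m A :=
  Equiv.ofBijective
    (fun a => ⟨(m : ℝ) • (a : EuclideanSpace ℝ (Fin n)), Finset.mem_image_of_mem _ a.2⟩)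
    ⟨fun a a' h => Subtype.ext (smul_right_injective _ (Nat.cast_ne_zero.2 hm)
      (congr_arg Subtype.val h)), fun ⟨y, hy⟩ => by
      obtain ⟨a, ha, rfl⟩ := Finset.mem_image.1 hy
      exact ⟨⟨a, ha⟩, rfl⟩⟩

lemma Fexp_stretch {n m : ℕ} (hm : m ≠ 0) (A : Finset (EuclideanSpace ℝ (Fin n)))
    (c : stretch m A → ℝ) (w : EuclideanSpace ℝ (Fin n)) :
    Fexp (stretch m A) c w = Fexp A (c ∘ stretchEquiv hm A) ((m : ℝ) • w) := by
  rw [Fexp, Fexp, ← (stretchEquiv hm A).sum_comp]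
  refine Finset.sum_congr rfl fun a _ => ?_
  have ha : (stretchEquiv hm A a : EuclideanSpace ℝ (Fin n)) =
      (m : ℝ) • (a : EuclideanSpace ℝ (Fin n)) := rfl
  rw [ha, real_inner_smul_left, real_inner_smul_right, Function.comp_apply]

lemma measurePreserving_coeffMeasure_stretch {n m : ℕ} (hm : m ≠ 0)
    (A : Fin n → Finset (EuclideanSpace ℝ (Fin n))) :
    MeasurePreserving (fun (c : ∀ i, stretch m (A i) → ℝ) i => c i ∘ stretchEquiv hm (A i))
      (coeffMeasure fun i => stretch m (A i)) (coeffMeasure A) :=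
  measurePreserving_pi _ _ fun i => measurePreserving_arrowCongr' (fun _ => gaussianReal 0 1)
    (fun _ => gaussianReal 0 1) (stretchEquiv hm (A i)).symm (MeasurableEquiv.refl ℝ)
    fun _ => MeasurePreserving.id _

/-- Theorem 1.5: for fixed supports `A_1,…,A_n` and `ε > 0`, the probability that the random
fewnomial system with stretched supports `mA_1,…,mA_n` has a common zero `w` with `‖w‖ > ε`
tends to `0` as `m → ∞`. -/
theorem real_concentrate_roots {n : ℕ}
    (A : Fin n → Finset (EuclideanSpace ℝ (Fin n))) (hA : ∀ i, (A i).Nonempty)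
    (ε : ℝ) (hε : 0 < ε) :
    Filter.Tendsto
      (fun m : ℕ =>
        coeffMeasure (fun i => stretch m (A i))
          {c | ∃ w : EuclideanSpace ℝ (Fin n), ε < ‖w‖ ∧
            ∀ i, Fexp (stretch m (A i)) (c i) w = 0})
      Filter.atTop (nhds 0) := by
  refine tendsto_of_tendsto_of_tendsto_of_le_of_le' tendsto_const_nhds
    (tendsto_coeffMeasure_exists_large_zero A hA hε) (Filter.Eventually.of_forall fun _ => zero_le)
    ((Filter.eventually_ne_atTop 0).mono fun m hm => ?_)
  rw [← (measurePreserving_coeffMeasure_stretch hm A).measure_preimage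
    (measurableSet_exists_large_zero A (m * ε)).nullMeasurableSet]
  refine measure_mono fun c ⟨w, hw, hw0⟩ => ⟨(m : ℝ) • w, ?_, fun i => ?_⟩
  · rw [norm_smul, Real.norm_natCast]
    gcongr
  · rw [← Fexp_stretch hm, hw0 i]

end
end

section
/- Let C ⊆ ℝ^n be a proper convex cone and let x lie in the interior of the dual cone C*. Then ∫_C e^{−⟨x,y⟩} dy = n! · vol{ y ∈ C : ⟨x,y⟩ ≤ 1 }, where vol denotes n-dimensional Lebesgue measure. -/
open MeasureTheory
open scoped ENNReal RealInnerProductSpace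

noncomputable section

/-- The dual cone `C* = {x : ⟨x,y⟩ ≥ 0 for all y ∈ C}`. -/
def dualCone {n : ℕ} (C : Set (EuclideanSpace ℝ (Fin n))) : Set (EuclideanSpace ℝ (Fin n)) :=
  {x | ∀ y ∈ C, 0 ≤ ⟪x, y⟫}

/-- A proper convex cone: convex, closed under positive scaling, full-dimensional
(nonempty interior) and pointed (its closure contains no line). -/
def IsProperCone {n : ℕ} (C : Set (EuclideanSpace ℝ (Fin n))) : Prop :=
  Convex ℝ C ∧ (∀ x ∈ C, ∀ t : ℝ, 0 < t → t • x ∈ C) ∧ (interior C).Nonempty ∧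
    ∀ p v : EuclideanSpace ℝ (Fin n), v ≠ 0 → ¬ ∀ t : ℝ, p + t • v ∈ closure C

open scoped Pointwise in
/-- The part of a cone in `ℝⁿ` where `⟪x, y⟫ ≤ t` has volume proportional to `t ^ n`. -/
theorem volume_cone_inner_le {n : ℕ} {C : Set (EuclideanSpace ℝ (Fin n))}
    (hC : ∀ y ∈ C, ∀ t : ℝ, 0 < t → t • y ∈ C) (x : EuclideanSpace ℝ (Fin n))
    {t : ℝ} (ht : 0 < t) :
    volume {y ∈ C | ⟪x, y⟫ ≤ t} = ENNReal.ofReal (t ^ n) * volume {y ∈ C | ⟪x, y⟫ ≤ 1} := by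
  have h : {y ∈ C | ⟪x, y⟫ ≤ t} = t • {y ∈ C | ⟪x, y⟫ ≤ 1} := by
    ext y
    rw [Set.mem_smul_set_iff_inv_smul_mem₀ ht.ne']
    simp only [Set.mem_ofPred_eq, real_inner_smul_right, inv_mul_le_iff₀ ht, mul_one]
    refine and_congr_left fun _ => ⟨fun hy => hC y hy _ (inv_pos.2 ht), fun hy => ?_⟩
    simpa [smul_smul, ht.ne'] using hC _ hy t ht
  rw [h, Measure.addHaar_smul, finrank_euclideanSpace_fin, abs_of_pos (pow_pos ht n)]

theorem lintegral_exp_neg_Ici (a : ℝ) :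
    ∫⁻ t in Set.Ici a, ENNReal.ofReal (Real.exp (-t)) = ENNReal.ofReal (Real.exp (-a)) := by
  rw [setLIntegral_congr Ioi_ae_eq_Ici.symm,
    ← ofReal_integral_eq_lintegral_ofReal (integrableOn_exp_neg_Ioi a)
      (Filter.Eventually.of_forall fun t => (Real.exp_pos _).le), integral_exp_neg_Ioi]

theorem lintegral_exp_neg_mul_pow (n : ℕ) :
    ∫⁻ t in Set.Ioi (0 : ℝ), ENNReal.ofReal (Real.exp (-t)) * ENNReal.ofReal (t ^ n) =
      n.factorial := by
  have hint := Real.GammaIntegral_convergent (s := n + 1) (by positivity)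
  have hG := Real.Gamma_eq_integral (s := n + 1) (by positivity)
  simp only [add_sub_cancel_right, Real.rpow_natCast] at hint hG
  rw [Real.Gamma_nat_eq_factorial] at hG
  simp_rw [← ENNReal.ofReal_mul (Real.exp_pos _).le]
  rw [← ofReal_integral_eq_lintegral_ofReal hint, ← hG, ENNReal.ofReal_natCast]
  filter_upwards [ae_restrict_mem measurableSet_Ioi] with t ht
  exact mul_nonneg (Real.exp_pos _).le (pow_nonneg (Set.mem_Ioi.1 ht).le n)

/-- Layer-cake formula for `exp (-f)`. -/
theorem lintegral_exp_neg_eq_lintegral_measure_le {α : Type*} [MeasurableSpace α]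
    (μ : Measure α) [SFinite μ] {f : α → ℝ} (hf : Measurable f) (hf0 : ∀ᵐ y ∂μ, 0 ≤ f y) :
    ∫⁻ y, ENNReal.ofReal (Real.exp (-f y)) ∂μ =
      ∫⁻ t in Set.Ioi (0 : ℝ), ENNReal.ofReal (Real.exp (-t)) * μ {y | f y ≤ t} := by
  let g : α → ℝ → ℝ≥0∞ := fun y => (Set.Ici (f y)).indicator fun t => ENNReal.ofReal (Real.exp (-t))
  have hg : Measurable (Function.uncurry g) :=
    Measurable.indicator (s := {p : α × ℝ | f p.1 ≤ p.2})
      (f := fun p : α × ℝ => ENNReal.ofReal (Real.exp (-p.2))) (by fun_prop)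
      (measurableSet_le (by fun_prop) (by fun_prop))
  calc ∫⁻ y, ENNReal.ofReal (Real.exp (-f y)) ∂μ
      = ∫⁻ y, (∫⁻ t in Set.Ioi (0 : ℝ), g y t) ∂μ := by
        refine lintegral_congr_ae (hf0.mono fun y hy => ?_)
        simp only [g]
        rw [setLIntegral_congr Ioi_ae_eq_Ici, setLIntegral_indicator measurableSet_Ici,
          Set.inter_eq_left.2 (Set.Ici_subset_Ici.2 hy), lintegral_exp_neg_Ici]
    _ = ∫⁻ t in Set.Ioi (0 : ℝ), ∫⁻ y, g y t ∂μ := lintegral_lintegral_swap hg.aemeasurable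
    _ = _ := by
        refine lintegral_congr fun t => ?_
        rw [← lintegral_indicator_const (measurableSet_le hf measurable_const)]
        rfl

/-- Lemma 2.4: for a proper cone `C` and `x` in the interior of `C*`,
`∫_C e^{-⟨x,y⟩} dy = n! · vol{y ∈ C : ⟨x,y⟩ ≤ 1}`. -/
theorem partial_volume {n : ℕ} (C : Set (EuclideanSpace ℝ (Fin n)))
    (hC : IsProperCone C) (x : EuclideanSpace ℝ (Fin n)) (hx : x ∈ interior (dualCone C)) :
    ∫ y in C, Real.exp (-⟪x, y⟫) =
      (n.factorial : ℝ) * (volume {y ∈ C | ⟪x, y⟫ ≤ 1}).toReal := by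
  have hnonneg : ∀ᵐ y ∂volume.restrict C, 0 ≤ ⟪x, y⟫ :=
    (ae_restrict_iff (measurableSet_le measurable_const (by fun_prop))).2
      (Filter.Eventually.of_forall (interior_subset hx))
  rw [integral_eq_lintegral_of_nonneg_ae
      (Filter.Eventually.of_forall fun y => (Real.exp_pos _).le)
      (by fun_prop : Continuous fun y => Real.exp (-⟪x, y⟫)).aestronglyMeasurable,
    lintegral_exp_neg_eq_lintegral_measure_le _ (by fun_prop) hnonneg,
    ← ENNReal.toReal_natCast, ← ENNReal.toReal_mul, ← lintegral_exp_neg_mul_pow,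
    ← lintegral_mul_const _ (by fun_prop)]
  congr 1
  refine setLIntegral_congr_fun measurableSet_Ioi fun t ht => ?_
  rw [mul_assoc, ← volume_cone_inner_le hC.2.1 x ht,
    Measure.restrict_apply (measurableSet_le (by fun_prop) measurable_const), Set.inter_comm]
  rfl

end
end

section
/- Let C ⊆ ℝ^n be a proper convex cone and let b_1,…,b_n ∈ C* be linearly independent vectors in the dual cone. Then |det [b_1,…,b_n]| · ∫_C e^{−⟨b_1 + ⋯ + b_n, y⟩} dy ≤ 1, where [b_1,…,b_n] is the n×n matrix with columns b_1,…,b_n. (In particular, b_1 + ⋯ + b_n lies in the interior of C*, so the integral is finite.) -/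
open MeasureTheory
open scoped ENNReal RealInnerProductSpace

noncomputable section

/-- The density of the standard exponential distribution. -/
def expDensity : ℝ → ℝ := (Set.Ici 0).indicator fun x => Real.exp (-x)

lemma expDensity_nonneg (x : ℝ) : 0 ≤ expDensity x :=
  Set.indicator_nonneg (fun _ _ => (Real.exp_pos _).le) x

lemma measurable_expDensity : Measurable expDensity :=
  (by fun_prop : Measurable fun x : ℝ => Real.exp (-x)).indicator measurableSet_Ici

lemma lintegral_prod_expDensity (ι : Type*) [Fintype ι] :
    ∫⁻ z : ι → ℝ, ENNReal.ofReal (∏ i, expDensity (z i)) = 1 := by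
  have hint : Integrable expDensity :=
    (integrable_indicator_iff measurableSet_Ici).2
      ((integrableOn_Ici_iff_integrableOn_Ioi (by simp)).2 (integrableOn_exp_neg_Ioi 0))
  have hone : ∫ x, expDensity x = 1 := by
    rw [expDensity, integral_indicator measurableSet_Ici, integral_Ici_eq_integral_Ioi,
      integral_exp_neg_Ioi_zero]
  have hprod : Integrable fun z : ι → ℝ => ∏ i, expDensity (z i) :=
    Integrable.fintype_prod fun _ => hint
  rw [← ofReal_integral_eq_lintegral_ofReal hprod
      (.of_forall fun z => Finset.prod_nonneg fun i _ => expDensity_nonneg _),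
    integral_fintype_prod_volume_eq_pow, hone]
  simp

/-- The integral of the exponential product density after a linear change of variables. -/
lemma ofReal_abs_det_mul_lintegral_prod_expDensity {ι : Type*} [Fintype ι] [DecidableEq ι]
    (M : Matrix ι ι ℝ) (hM : M.det ≠ 0) :
    ENNReal.ofReal |M.det| *
      ∫⁻ x : ι → ℝ, ENNReal.ofReal (∏ i, expDensity (M.mulVec x i)) = 1 := by
  have hmeas : Measurable fun z : ι → ℝ => ENNReal.ofReal (∏ i, expDensity (z i)) :=
    (Finset.measurable_prod _ fun i _ =>
      measurable_expDensity.comp (measurable_pi_apply i)).ennreal_ofReal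
  have hlin : Measurable (Matrix.toLin' M) :=
    (LinearMap.continuous_of_finiteDimensional _).measurable
  have hmap := lintegral_map (μ := volume) hmeas hlin
  rw [Real.map_matrix_volume_pi_eq_smul_volume_pi hM, lintegral_smul_measure,
    lintegral_prod_expDensity] at hmap
  simp only [Matrix.toLin'_apply] at hmap
  rw [← hmap, smul_eq_mul, mul_one, ← ENNReal.ofReal_mul (abs_nonneg _), ← abs_mul,
    mul_inv_cancel₀ hM]
  simp

/-- Proposition 2.5 (main inequality): for a proper cone `C ⊆ ℝ^n` and linearly independent
`b_1,…,b_n ∈ C*`, `|det[b_1,…,b_n]| · ∫_C e^{-⟨b_1+⋯+b_n, y⟩} dy ≤ 1` (in particular the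
integral is finite). -/
theorem crucial_trick {n : ℕ} (C : Set (EuclideanSpace ℝ (Fin n))) (hC : IsProperCone C)
    (b : Fin n → EuclideanSpace ℝ (Fin n)) (hli : LinearIndependent ℝ b)
    (hb : ∀ i, b i ∈ dualCone C) :
    ENNReal.ofReal |(Matrix.of fun (i : Fin n) (j : Fin n) => b j i).det| *
      ∫⁻ y in C, ENNReal.ofReal (Real.exp (-⟪∑ i, b i, y⟫)) ≤ 1 := by
  set M : Matrix (Fin n) (Fin n) ℝ := Matrix.of fun i j => b j i
  by_cases hdet : M.det = 0
  · simp [hdet]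
  have hinner : ∀ (i : Fin n) (y : EuclideanSpace ℝ (Fin n)),
      ⟪b i, y⟫ = M.transpose.mulVec y.ofLp i := fun i y => by
    simp [M, PiLp.inner_apply, Matrix.mulVec, dotProduct, mul_comm]
  have hmeas : ∀ i, Measurable fun y : EuclideanSpace ℝ (Fin n) => ⟪b i, y⟫ := fun i => by
    fun_prop
  let S : Set (EuclideanSpace ℝ (Fin n)) := {y | ∀ i, 0 ≤ ⟪b i, y⟫}
  have hS : MeasurableSet S := by
    simp only [S, Set.ofPred_forall]
    exact .iInter fun i => measurableSet_le measurable_const (hmeas i)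
  have hCS : C ⊆ S := fun y hy i => hb i y hy
  have hle : ∫⁻ y in C, ENNReal.ofReal (Real.exp (-⟪∑ i, b i, y⟫)) ≤
      ∫⁻ y : EuclideanSpace ℝ (Fin n), ENNReal.ofReal (∏ i, expDensity ⟪b i, y⟫) := calc
    _ ≤ ∫⁻ y in S, ENNReal.ofReal (Real.exp (-⟪∑ i, b i, y⟫)) := lintegral_mono_set hCS
    _ = ∫⁻ y in S, ENNReal.ofReal (∏ i, expDensity ⟪b i, y⟫) :=
      setLIntegral_congr_fun hS fun y hy => by
        have h : ∀ i, expDensity ⟪b i, y⟫ = Real.exp (-⟪b i, y⟫) := fun i =>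
          Set.indicator_of_mem (hy i) _
        simp only [h, ← Real.exp_sum, sum_inner, Finset.sum_neg_distrib]
    _ ≤ _ := setLIntegral_le_lintegral _ _
  refine (mul_le_mul_right hle _).trans_eq ?_
  rw [← (PiLp.volume_preserving_toLp (Fin n)).lintegral_comp_emb
    (MeasurableEquiv.toLp 2 _).measurableEmbedding]
  simp only [hinner]
  rw [← Matrix.det_transpose]
  exact ofReal_abs_det_mul_lintegral_prod_expDensity _ (by rwa [Matrix.det_transpose])

end
end

section
/- Let A_1,…,A_n ⊆ ℝ^n be finite nonempty sets with convex hulls P_1,…,P_n and P = P_1 + ⋯ + P_n. Consider the map ψ : ℝ_{>0}^n → ℙ(ℝ^{A_1}) × ⋯ × ℙ(ℝ^{A_n}) given by ψ(x) = (ψ_1(x),…,ψ_n(x)) with ψ_i(x) = [x^a]_{a∈A_i}, where x^a = ∏_{j=1}^n x_j^{a_j} (real exponents) and [·] denotes the projective class of a nonzero vector. Then ψ is injective if and only if P is n-dimensional (i.e., the affine span of P is all of ℝ^n). -/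
open Pointwise

noncomputable section

/-- The map `ψ : ℝ^n_{>0} → ℙ(ℝ^{A_1}) × ⋯ × ℙ(ℝ^{A_n})`, `ψ_i(x) = [x^a]_{a ∈ A_i}`,
where `x^a = ∏_j x_j^{a_j} = exp(∑_j a_j log x_j) > 0` (real exponents); the vector
`(x^a)_{a ∈ A_i}` is nonzero since `A_i` is nonempty, so its projective class is defined.
(The formula agrees with `x^a` for `x` in the positive orthant.) -/
def psiMap {n : ℕ} (A : Fin n → Finset (EuclideanSpace ℝ (Fin n)))
    (hA : ∀ i, (A i).Nonempty) (x : EuclideanSpace ℝ (Fin n)) :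
    ∀ i, Projectivization ℝ (A i → ℝ) :=
  fun i => Projectivization.mk ℝ
    (fun a => Real.exp (∑ j, (a : EuclideanSpace ℝ (Fin n)) j * Real.log (x j)))
    (by
      obtain ⟨a, ha⟩ := hA i
      intro h
      exact (Real.exp_pos _).ne' (congrFun h ⟨a, ha⟩))

/-- Two points have the same image under `psiMap` iff the difference of their coordinatewise
logarithms has constant inner product with the points of each `A i`. -/
lemma psiMap_eq_iff {n : ℕ} (A : Fin n → Finset (EuclideanSpace ℝ (Fin n)))
    (hA : ∀ i, (A i).Nonempty) (x y : EuclideanSpace ℝ (Fin n)) :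
    psiMap A hA x = psiMap A hA y ↔ ∀ i, ∀ a ∈ A i, ∀ b ∈ A i,
      ∑ j, a j * (Real.log (x j) - Real.log (y j)) =
        ∑ j, b j * (Real.log (x j) - Real.log (y j)) := by
  simp only [funext_iff, psiMap, Projectivization.mk_eq_mk_iff', Pi.smul_apply, smul_eq_mul,
    mul_sub, Finset.sum_sub_distrib]
  refine forall_congr' fun i => ⟨?_, fun h => ?_⟩
  · rintro ⟨c, hc⟩ a ha b hb
    have key : ∀ d ∈ A i, Real.exp (∑ j, d j * Real.log (x j) - ∑ j, d j * Real.log (y j)) = c := by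
      intro d hd
      rw [Real.exp_sub, ← hc ⟨d, hd⟩, mul_div_cancel_right₀ _ (Real.exp_pos _).ne']
    exact Real.exp_injective ((key a ha).trans (key b hb).symm)
  · obtain ⟨a, ha⟩ := hA i
    refine ⟨Real.exp (∑ j, a j * Real.log (x j) - ∑ j, a j * Real.log (y j)), fun b => ?_⟩
    rw [← Real.exp_add, h a ha b b.2, sub_add_cancel]

/-- A nonempty set affinely spans a finite-dimensional inner product space iff no nonzero vector
has constant inner product with its points. -/
lemma affineSpan_eq_top_iff_forall_inner {E : Type*} [NormedAddCommGroup E]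
    [InnerProductSpace ℝ E] [FiniteDimensional ℝ E] {s : Set E} (hs : s.Nonempty) :
    affineSpan ℝ s = ⊤ ↔
      ∀ v : E, (∀ p ∈ s, ∀ q ∈ s, inner ℝ p v = inner ℝ q v) → v = 0 := by
  rw [← AffineSubspace.direction_eq_top_iff_of_nonempty ((affineSpan_nonempty ℝ).2 hs),
    direction_affineSpan, ← Submodule.orthogonal_eq_bot_iff, Submodule.eq_bot_iff]
  refine forall_congr' fun v => imp_congr_left ?_
  rw [vectorSpan_def, Submodule.mem_orthogonal]
  constructor
  · intro h p hp q hq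
    have := h (p - q) (Submodule.subset_span (Set.vsub_mem_vsub hp hq))
    rwa [inner_sub_left, sub_eq_zero] at this
  · intro h u hu
    induction hu using Submodule.span_induction with
    | mem u hu =>
      obtain ⟨p, hp, q, hq, rfl⟩ := hu
      change inner ℝ (p - q) v = 0
      rw [inner_sub_left, h p hp q hq, sub_self]
    | zero => exact inner_zero_left v
    | add u w _ _ hu hw => rw [inner_add_left, hu, hw, add_zero]
    | smul c u _ hu => rw [inner_smul_left, hu, mul_zero]

/-- A linear functional is constant on a Minkowski sum of convex hulls of nonempty sets iff it is
constant on each of these sets. -/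
lemma forall_inner_eq_sum_convexHull_iff {ι E : Type*} [Fintype ι] [NormedAddCommGroup E]
    [InnerProductSpace ℝ E] {A : ι → Set E} (hA : ∀ i, (A i).Nonempty) (v : E) :
    (∀ p ∈ ∑ i, convexHull ℝ (A i), ∀ q ∈ ∑ i, convexHull ℝ (A i),
      inner ℝ p v = inner ℝ q v) ↔
      ∀ i, ∀ a ∈ A i, ∀ b ∈ A i, inner ℝ a v = inner ℝ b v := by
  classical
  choose c hc using hA
  constructor
  · intro h i a ha b hb
    have mem : ∀ d ∈ A i, ∑ j, Function.update c i d j ∈ ∑ j, convexHull ℝ (A j) := by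
      intro d hd
      refine Set.finsetSum_mem_finsetSum _ _ _ fun j _ => subset_convexHull ℝ _ ?_
      by_cases hj : j = i
      · subst hj
        simpa using hd
      · simpa [hj] using hc j
    have := h _ (mem a ha) _ (mem b hb)
    simpa [Finset.sum_update_of_mem, inner_add_left] using this
  · intro h
    have key : ∀ p ∈ ∑ i, convexHull ℝ (A i), inner ℝ p v = ∑ i, inner ℝ (c i) v := by
      intro p hp
      obtain ⟨g, hg, rfl⟩ := (Set.mem_fintype_sum _ _).1 hp
      rw [sum_inner]
      refine Finset.sum_congr rfl fun i _ => ?_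
      have hconv : Convex ℝ {p : E | inner ℝ p v = inner ℝ (c i) v} := by
        intro p hp q hq s t _ _ hst
        simp only [Set.mem_ofPred_eq] at hp hq ⊢
        rw [inner_add_left, real_inner_smul_left, real_inner_smul_left, hp, hq, ← add_mul, hst,
          one_mul]
      exact convexHull_min (fun a ha => h i a ha _ (hc i)) hconv (hg i)
    intro p hp q hq
    rw [key p hp, key q hq]

/-- Lemma 4.1: `ψ` is injective on the positive orthant if and only if the Minkowski sum
`P = P_1 + ⋯ + P_n` of the Newton polytopes is `n`-dimensional, i.e. its affine span is
all of `ℝ^n`. -/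
theorem psi_injective_iff {n : ℕ} (A : Fin n → Finset (EuclideanSpace ℝ (Fin n)))
    (hA : ∀ i, (A i).Nonempty) :
    Set.InjOn (psiMap A hA) {x : EuclideanSpace ℝ (Fin n) | ∀ j, 0 < x j} ↔
      affineSpan ℝ
        (∑ i, convexHull ℝ ((A i : Set (EuclideanSpace ℝ (Fin n))))) = ⊤ := by
  have hne : (∑ i, convexHull ℝ ((A i : Set (EuclideanSpace ℝ (Fin n))))).Nonempty := by
    choose c hc using hA
    exact ⟨_, Set.finsetSum_mem_finsetSum _ _ c fun i _ => subset_convexHull ℝ _ (hc i)⟩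
  rw [affineSpan_eq_top_iff_forall_inner hne]
  simp only [forall_inner_eq_sum_convexHull_iff (fun i => Finset.coe_nonempty.2 (hA i)),
    Finset.mem_coe]
  have inner_eq : ∀ a v : EuclideanSpace ℝ (Fin n), inner ℝ a v = ∑ j, a j * v j := by
    intro a v
    simp [PiLp.inner_apply, mul_comm]
  simp only [inner_eq]
  constructor
  · intro h v hv
    have hxy := @h (WithLp.toLp 2 fun j => Real.exp (v j)) (fun j => Real.exp_pos _)
      (WithLp.toLp 2 fun _ => 1) (fun _ => one_pos)
      ((psiMap_eq_iff A hA _ _).2 (by simpa using hv))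
    ext j
    simpa using congrArg (fun z : EuclideanSpace ℝ (Fin n) => z j) hxy
  · intro h x hx y hy hxy
    have hv := h (WithLp.toLp 2 fun j => Real.log (x j) - Real.log (y j))
      ((psiMap_eq_iff A hA x y).1 hxy)
    ext j
    have hj : Real.log (x j) - Real.log (y j) = 0 := by
      simpa using congrArg (fun z : EuclideanSpace ℝ (Fin n) => z j) hv
    exact Real.log_injOn_pos (hx j) (hy j) (sub_eq_zero.1 hj)

end
end

section
/- Let C ⊆ ℝ^n be a proper convex cone, let d lie in the interior of the dual cone C*, and let ε > 0. Then lim_{m→∞} m^n · ∫_{C ∩ {w : ‖w‖ ≥ ε}} e^{−m⟨d,w⟩} dw = 0, where the limit is over positive integers m and the integral is with respect to Lebesgue measure. -/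
open MeasureTheory
open scoped ENNReal RealInnerProductSpace

noncomputable section

lemma integrable_exp_neg_mul_norm {E : Type*} [NormedAddCommGroup E] [NormedSpace ℝ E]
    [FiniteDimensional ℝ E] [MeasurableSpace E] [BorelSpace E] (μ : Measure E)
    [μ.IsAddHaarMeasure] {a : ℝ} (ha : 0 < a) :
    Integrable (fun x : E => Real.exp (-(a * ‖x‖))) μ := by
  set k : ℕ := Module.finrank ℝ E + 1 with hk
  have hint : Integrable (fun x : E => (1 + ‖x‖) ^ (-(k : ℝ))) μ :=
    integrable_one_add_norm (by rw [hk]; push_cast; linarith)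
  refine (hint.const_mul (k.factorial * Real.exp a * (a ^ k)⁻¹)).mono'
    (by fun_prop) (Filter.Eventually.of_forall fun x => ?_)
  have hx : 0 < 1 + ‖x‖ := by positivity
  have h := Real.pow_div_factorial_le_exp (a * (1 + ‖x‖)) (by positivity) k
  rw [Real.norm_of_nonneg (Real.exp_pos _).le, Real.rpow_neg hx.le, Real.rpow_natCast,
    Real.exp_neg]
  rw [mul_add, mul_one, Real.exp_add, ← mul_one_add, mul_pow] at h
  rw [inv_le_iff_one_le_mul₀ (Real.exp_pos _)]
  rw [div_le_iff₀ (by positivity)] at h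
  calc (1 : ℝ) = (a ^ k * (1 + ‖x‖) ^ k) * ((a ^ k)⁻¹ * ((1 + ‖x‖) ^ k)⁻¹) := by
        field_simp
    _ ≤ (Real.exp a * Real.exp (a * ‖x‖) * k.factorial) *
        ((a ^ k)⁻¹ * ((1 + ‖x‖) ^ k)⁻¹) := by gcongr
    _ = _ := by ring

lemma exists_mul_norm_le_inner_of_mem_interior_dualCone {n : ℕ}
    {C : Set (EuclideanSpace ℝ (Fin n))} {d : EuclideanSpace ℝ (Fin n)}
    (hd : d ∈ interior (dualCone C)) : ∃ c > 0, ∀ y ∈ C, c * ‖y‖ ≤ ⟪d, y⟫ := by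
  obtain ⟨r, hr, hball⟩ := Metric.mem_nhds_iff.1 (mem_interior_iff_mem_nhds.1 hd)
  refine ⟨r / 2, by positivity, fun y hy => ?_⟩
  rcases eq_or_ne y 0 with rfl | hy0
  · simp
  have hn : 0 < ‖y‖ := norm_pos_iff.2 hy0
  have hmem : d - (r / 2 / ‖y‖) • y ∈ Metric.ball d r := by
    rw [mem_ball_iff_norm, sub_sub_cancel_left, norm_neg, norm_smul,
      Real.norm_of_nonneg (by positivity), div_mul_cancel₀ _ hn.ne']
    linarith
  have h := hball hmem y hy
  rw [inner_sub_left, real_inner_smul_left, real_inner_self_eq_norm_sq] at h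
  have : r / 2 / ‖y‖ * ‖y‖ ^ 2 = r / 2 * ‖y‖ := by field_simp
  linarith

/-- Lemma 4.2: for a proper cone `C`, `d ∈ int C*` and `ε > 0`,
`m^n · ∫_{C ∩ {‖w‖ ≥ ε}} e^{-m⟨d,w⟩} dw → 0` as `m → ∞`. -/
theorem lim_eI {n : ℕ} (C : Set (EuclideanSpace ℝ (Fin n))) (hC : IsProperCone C)
    (d : EuclideanSpace ℝ (Fin n)) (hd : d ∈ interior (dualCone C)) (ε : ℝ) (hε : 0 < ε) :
    Filter.Tendsto
      (fun m : ℕ => (m : ℝ≥0∞) ^ n *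
        ∫⁻ w in C ∩ {w : EuclideanSpace ℝ (Fin n) | ε ≤ ‖w‖},
          ENNReal.ofReal (Real.exp (-((m : ℝ) * ⟪d, w⟫))))
      Filter.atTop (nhds 0) := by
  obtain ⟨c, hc, hcone⟩ := exists_mul_norm_le_inner_of_mem_interior_dualCone hd
  set T : Set (EuclideanSpace ℝ (Fin n)) := {w | ε ≤ ‖w‖ ∧ c * ‖w‖ ≤ ⟪d, w⟫}
  have hTmeas : MeasurableSet T :=
    (measurableSet_le measurable_const measurable_norm).inter
      (measurableSet_le (f := fun w : EuclideanSpace ℝ (Fin n) => c * ‖w‖)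
        (g := fun w => ⟪d, w⟫) (by fun_prop) (by fun_prop))
  set K : ℝ≥0∞ := ∫⁻ w : EuclideanSpace ℝ (Fin n), ENNReal.ofReal (Real.exp (-(c / 2 * ‖w‖)))
  have hKtop : K ≠ ∞ :=
    (integrable_exp_neg_mul_norm volume (half_pos hc)).lintegral_lt_top.ne
  have hbound (m : ℕ) (hm : 1 ≤ m) :
      (m : ℝ≥0∞) ^ n * ∫⁻ w in C ∩ {w : EuclideanSpace ℝ (Fin n) | ε ≤ ‖w‖},
          ENNReal.ofReal (Real.exp (-((m : ℝ) * ⟪d, w⟫))) ≤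
        ENNReal.ofReal ((m : ℝ) ^ n * Real.exp (-(c / 2 * ε)) ^ m) * K := by
    have hm' : (1 : ℝ) ≤ m := by exact_mod_cast hm
    rw [ENNReal.ofReal_mul (by positivity), ENNReal.ofReal_pow (by positivity),
      ENNReal.ofReal_natCast, mul_assoc]
    gcongr
    calc _ ≤ ∫⁻ w in T, ENNReal.ofReal (Real.exp (-((m : ℝ) * ⟪d, w⟫))) :=
          lintegral_mono_set fun w hw => ⟨hw.2, hcone w hw.1⟩
      _ ≤ ∫⁻ w in T, ENNReal.ofReal (Real.exp (-(c / 2 * ε)) ^ m) *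
            ENNReal.ofReal (Real.exp (-(c / 2 * ‖w‖))) := by
          refine setLIntegral_mono' hTmeas fun w hw => ?_
          rw [← ENNReal.ofReal_mul (by positivity), ← Real.exp_nat_mul, ← Real.exp_add]
          refine ENNReal.ofReal_le_ofReal (Real.exp_le_exp.2 ?_)
          have h₁ : (m : ℝ) * (c * ‖w‖) ≤ m * ⟪d, w⟫ := by gcongr; exact hw.2
          have h₂ : (m : ℝ) * (c / 2 * ε) ≤ m * (c / 2 * ‖w‖) := by gcongr; exact hw.1
          have h₃ : 1 * (c / 2 * ‖w‖) ≤ m * (c / 2 * ‖w‖) := by gcongr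
          linarith
      _ ≤ ∫⁻ w, ENNReal.ofReal (Real.exp (-(c / 2 * ε)) ^ m) *
            ENNReal.ofReal (Real.exp (-(c / 2 * ‖w‖))) := setLIntegral_le_lintegral _ _
      _ = _ := lintegral_const_mul' _ _ ENNReal.ofReal_ne_top
  have hlim : Filter.Tendsto
      (fun m : ℕ => ENNReal.ofReal ((m : ℝ) ^ n * Real.exp (-(c / 2 * ε)) ^ m) * K)
      Filter.atTop (nhds 0) := by
    have hr : |Real.exp (-(c / 2 * ε))| < 1 := by
      rw [abs_of_pos (Real.exp_pos _), Real.exp_lt_one_iff]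
      have : 0 < c / 2 * ε := by positivity
      linarith
    have h := ENNReal.tendsto_ofReal (tendsto_pow_const_mul_const_pow_of_abs_lt_one n hr)
    simpa using ENNReal.Tendsto.mul_const h (Or.inr hKtop)
  refine tendsto_of_tendsto_of_tendsto_of_le_of_le' tendsto_const_nhds hlim
    (Filter.Eventually.of_forall fun _ => zero_le) ?_
  filter_upwards [Filter.eventually_ge_atTop 1] with m hm using hbound m hm

end
end

section
/- For i = 1,…,n, let A_i = {a_i, b_i} ⊆ ℝ^n be a two-element set such that the vectors b_1 − a_1, …, b_n − a_n are linearly independent. Then E(A_1,…,A_n) = 2^{−n}. -/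
open MeasureTheory ProbabilityTheory Pointwise
open scoped ENNReal RealInnerProductSpace

noncomputable section

/-- Two distinct coordinates of a standard Gaussian vector have opposite signs with
probability one half. -/
theorem gaussian_pi_mul_neg {ι : Type*} [Fintype ι] {i j : ι} (hij : i ≠ j) :
    (Measure.pi fun _ : ι => gaussianReal 0 1) {x : ι → ℝ | x i * x j < 0} = 2⁻¹ := by
  classical
  set μ := Measure.pi fun _ : ι => gaussianReal 0 1
  have : NullSingletonClass (gaussianReal 0 1) := nullSingletonClass_gaussianReal one_ne_zero
  have hneg : MeasurableSet {x : ι → ℝ | x i * x j < 0} :=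
    measurableSet_lt (by fun_prop) measurable_const
  have hflip : MeasurePreserving
      (fun (x : ι → ℝ) k => (if k = i then Neg.neg else id : ℝ → ℝ) (x k)) μ μ := by
    refine measurePreserving_pi (fun _ : ι => gaussianReal 0 1) (fun _ : ι => gaussianReal 0 1)
      (f := fun k => (if k = i then Neg.neg else id : ℝ → ℝ)) fun k => ?_
    by_cases hk : k = i
    · simp only [hk, if_true]
      exact ⟨measurable_neg, by simpa using gaussianReal_map_neg (μ := 0) (v := 1)⟩
    · simp only [hk, if_false]
      exact MeasurePreserving.id _
  have hsymm : μ {x | 0 < x i * x j} = μ {x | x i * x j < 0} := by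
    rw [← hflip.measure_preimage hneg.nullMeasurableSet]
    congr 1
    ext x
    simp [hij.symm]
  have hzero : ∀ k, μ {x | x k = 0} = 0 := fun k => Measure.pi_hyperplane _ k 0
  have hne : μ {x | x i * x j < 0}ᶜ = μ {x | 0 < x i * x j} := by
    apply measure_congr
    have h : ∀ k, ∀ᵐ x ∂μ, x k ≠ 0 := fun k => by
      simpa [ae_iff] using hzero k
    filter_upwards [h i, h j] with x hi hj
    have := mul_ne_zero hi hj
    refine propext ?_
    change ¬ (x i * x j < 0) ↔ 0 < x i * x j
    rw [not_lt]
    exact ⟨fun h => lt_of_le_of_ne h this.symm, le_of_lt⟩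
  have hsum := measure_add_measure_compl (μ := μ) hneg
  rw [hne, hsymm, measure_univ, ← two_mul] at hsum
  exact ENNReal.eq_inv_of_mul_eq_one_left (by rwa [mul_comm])

/-- The linear map given by pairing with `n` linearly independent vectors of `ℝ^n` is
bijective. -/
theorem bijective_inner_of_linearIndependent {n : ℕ} {d : Fin n → EuclideanSpace ℝ (Fin n)}
    (hd : LinearIndependent ℝ d) :
    Function.Bijective fun (v : EuclideanSpace ℝ (Fin n)) i => ⟪d i, v⟫ := by
  let L : EuclideanSpace ℝ (Fin n) →ₗ[ℝ] (Fin n → ℝ) := LinearMap.pi fun i => innerₛₗ ℝ (d i)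
  have hinj : Function.Injective L := by
    rw [injective_iff_map_eq_zero]
    intro v hv
    have hspan := hd.span_eq_top_of_card_eq_finrank' (by simp)
    have hle : Submodule.span ℝ (Set.range d) ≤ (ℝ ∙ v)ᗮ := by
      rw [Submodule.span_le]
      rintro _ ⟨i, rfl⟩
      have h : ⟪d i, v⟫ = 0 := congrFun hv i
      exact Submodule.mem_orthogonal_singleton_iff_inner_left.2 h
    rw [hspan] at hle
    exact inner_self_eq_zero.1
      (Submodule.mem_orthogonal_singleton_iff_inner_left.1 (hle (Submodule.mem_top (x := v))))
  exact ⟨hinj, (LinearMap.injective_iff_surjective_of_finrank_eq_finrank (by simp)).1 hinj⟩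

section Binomial

variable {n : ℕ} {A : Fin n → Finset (EuclideanSpace ℝ (Fin n))}
  {a b : ∀ i, A i}

theorem sysF_binomial (hab : ∀ i, a i ≠ b i) (hA : ∀ i x, x = a i ∨ x = b i)
    (c : ∀ i, A i → ℝ) (w : EuclideanSpace ℝ (Fin n)) (i : Fin n) :
    sysF A c w i = c i (a i) * Real.exp ⟪(a i : EuclideanSpace ℝ (Fin n)), w⟫ +
      c i (b i) * Real.exp ⟪(b i : EuclideanSpace ℝ (Fin n)), w⟫ :=
  Fintype.sum_eq_add (a i) (b i) (hab i) fun x hx => ((hA i x).elim hx.1 hx.2).elim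

theorem fderiv_sysF_binomial (hab : ∀ i, a i ≠ b i) (hA : ∀ i x, x = a i ∨ x = b i)
    (c : ∀ i, A i → ℝ) {w : EuclideanSpace ℝ (Fin n)} (hw : sysF A c w = 0)
    (v : EuclideanSpace ℝ (Fin n)) (i : Fin n) :
    fderiv ℝ (sysF A c) w v i =
      c i (b i) * Real.exp ⟪(b i : EuclideanSpace ℝ (Fin n)), w⟫ *
        ⟪(b i : EuclideanSpace ℝ (Fin n)) - a i, v⟫ := by
  have hexp : ∀ u : EuclideanSpace ℝ (Fin n), HasFDerivAt
      (fun w : EuclideanSpace ℝ (Fin n) => Real.exp ⟪u, w⟫) (Real.exp ⟪u, w⟫ • innerSL ℝ u) w :=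
    fun u => (innerSL ℝ u).hasFDerivAt.exp
  have hF : HasFDerivAt (sysF A c) (ContinuousLinearMap.pi fun i =>
      c i (a i) • Real.exp ⟪(a i : EuclideanSpace ℝ (Fin n)), w⟫ •
        innerSL ℝ (a i : EuclideanSpace ℝ (Fin n)) +
      c i (b i) • Real.exp ⟪(b i : EuclideanSpace ℝ (Fin n)), w⟫ •
        innerSL ℝ (b i : EuclideanSpace ℝ (Fin n))) w := by
    rw [hasFDerivAt_pi]
    intro i
    have := ((hexp (a i)).const_mul (c i (a i))).add ((hexp (b i)).const_mul (c i (b i)))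
    refine this.congr_of_eventuallyEq (.of_forall fun w => ?_)
    exact sysF_binomial hab hA c w i
  have hz := congrFun hw i
  rw [sysF_binomial hab hA, Pi.zero_apply] at hz
  rw [hF.fderiv]
  simp only [ContinuousLinearMap.coe_pi', add_apply, smul_apply,
    innerSL_apply_apply, smul_eq_mul, inner_sub_left]
  linear_combination ⟪(a i : EuclideanSpace ℝ (Fin n)), v⟫ * hz

theorem mem_nondegZeros_binomial (hab : ∀ i, a i ≠ b i) (hA : ∀ i x, x = a i ∨ x = b i)
    (hind : LinearIndependent ℝ fun i => (b i : EuclideanSpace ℝ (Fin n)) - a i)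
    (c : ∀ i, A i → ℝ) (w : EuclideanSpace ℝ (Fin n)) :
    w ∈ nondegZeros A c ↔ (∀ i, c i (a i) * c i (b i) < 0) ∧
      ∀ i, ⟪(b i : EuclideanSpace ℝ (Fin n)) - a i, w⟫ =
        Real.log (-(c i (a i) / c i (b i))) := by
  have hL := bijective_inner_of_linearIndependent hind
  constructor
  · rintro ⟨hw, hbij⟩
    have hpt : ∀ i, c i (a i) * c i (b i) < 0 ∧
        ⟪(b i : EuclideanSpace ℝ (Fin n)) - a i, w⟫ =
          Real.log (-(c i (a i) / c i (b i))) := by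
      intro i
      have hb : c i (b i) ≠ 0 := by
        intro hb
        obtain ⟨v, hv⟩ := hbij.2 1
        have h := congrFun hv i
        rw [fderiv_sysF_binomial hab hA c hw, hb] at h
        simp at h
      have hz := congrFun hw i
      rw [sysF_binomial hab hA, Pi.zero_apply] at hz
      have hratio : -(c i (a i) / c i (b i)) =
          Real.exp ⟪(b i : EuclideanSpace ℝ (Fin n)) - a i, w⟫ := by
        rw [inner_sub_left, Real.exp_sub]
        field_simp
        linarith
      refine ⟨?_, by rw [hratio, Real.log_exp]⟩
      have hp : 0 < -(c i (a i) / c i (b i)) * c i (b i) ^ 2 :=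
        mul_pos (hratio ▸ Real.exp_pos _) (by positivity)
      have he : -(c i (a i) / c i (b i)) * c i (b i) ^ 2 = -(c i (a i) * c i (b i)) := by
        field_simp
      linarith
    exact ⟨fun i => (hpt i).1, fun i => (hpt i).2⟩
  · rintro ⟨hc, hlog⟩
    have hb : ∀ i, c i (b i) ≠ 0 := fun i h => by simpa [h] using hc i
    have hw : sysF A c w = 0 := by
      ext i
      have hq : 0 < -(c i (a i) / c i (b i)) := by
        have he : -(c i (a i) / c i (b i)) = -(c i (a i) * c i (b i)) / c i (b i) ^ 2 := by
          have := hb i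
          field_simp
        rw [he]
        exact div_pos (neg_pos.2 (hc i)) (sq_pos_of_ne_zero (hb i))
      have h := congrArg Real.exp (hlog i)
      rw [Real.exp_log hq, inner_sub_left, Real.exp_sub] at h
      have hbi := hb i
      field_simp at h
      rw [sysF_binomial hab hA, Pi.zero_apply]
      linarith
    refine ⟨hw, ?_⟩
    have hinj : Function.Injective (fderiv ℝ (sysF A c) w).toLinearMap := by
      rw [injective_iff_map_eq_zero]
      intro v hv
      apply hL.1
      ext i
      have h : fderiv ℝ (sysF A c) w v i = 0 := congrFun hv i
      rw [fderiv_sysF_binomial hab hA c hw] at h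
      simpa [hb i] using h
    exact ⟨hinj, (LinearMap.injective_iff_surjective_of_finrank_eq_finrank (by simp)).1 hinj⟩

theorem encard_nondegZeros_binomial (hab : ∀ i, a i ≠ b i) (hA : ∀ i x, x = a i ∨ x = b i)
    (hind : LinearIndependent ℝ fun i => (b i : EuclideanSpace ℝ (Fin n)) - a i)
    (c : ∀ i, A i → ℝ) :
    ((nondegZeros A c).encard : ℝ≥0∞) =
      (Set.univ.pi fun i => {x : A i → ℝ | x (a i) * x (b i) < 0}).indicator 1 c := by
  by_cases hc : ∀ i, c i (a i) * c i (b i) < 0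
  · obtain ⟨w, hw⟩ := (bijective_inner_of_linearIndependent hind).2
      fun i => Real.log (-(c i (a i) / c i (b i)))
    have hset : nondegZeros A c = {w} := by
      ext w'
      rw [mem_nondegZeros_binomial hab hA hind, Set.mem_singleton_iff]
      constructor
      · rintro ⟨-, h⟩
        exact (bijective_inner_of_linearIndependent hind).1 ((funext h).trans hw.symm)
      · rintro rfl
        exact ⟨hc, congrFun hw⟩
    rw [Set.indicator_of_mem (by simpa using hc), hset]
    simp
  · have hset : nondegZeros A c = ∅ := by
      ext w
      simp [mem_nondegZeros_binomial hab hA hind, hc]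
    rw [Set.indicator_of_notMem (by simpa using hc), hset]
    simp

theorem EE_binomial (hab : ∀ i, a i ≠ b i) (hA : ∀ i x, x = a i ∨ x = b i)
    (hind : LinearIndependent ℝ fun i => (b i : EuclideanSpace ℝ (Fin n)) - a i) :
    EE A = ((2 : ℝ≥0∞) ^ n)⁻¹ := by
  have hmeas : MeasurableSet
      (Set.univ.pi fun i => {x : A i → ℝ | x (a i) * x (b i) < 0}) :=
    .univ_pi fun i => measurableSet_lt (by fun_prop) measurable_const
  rw [EE, lintegral_congr (encard_nondegZeros_binomial hab hA hind), lintegral_indicator_one hmeas,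
    coeffMeasure, Measure.pi_pi]
  simp [gaussian_pi_mul_neg (hab _), ENNReal.inv_pow]

end Binomial

open Classical in
/-- Example 4.3: if `A_i = {a_i, b_i}` with `b_1 - a_1, …, b_n - a_n` linearly independent,
then `E(A_1,…,A_n) = 2^{-n}`. -/
theorem EE_binomial_system {n : ℕ} (a b : Fin n → EuclideanSpace ℝ (Fin n))
    (hab : ∀ i, a i ≠ b i)
    (hind : LinearIndependent ℝ (fun i => b i - a i)) :
    EE (fun i => ({a i, b i} : Finset (EuclideanSpace ℝ (Fin n)))) =
      ((2 : ℝ≥0∞) ^ n)⁻¹ := by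
  refine EE_binomial (a := fun i => ⟨a i, by simp⟩) (b := fun i => ⟨b i, by simp⟩) ?_ ?_ hind
  · exact fun i h => hab i (congrArg Subtype.val h)
  · rintro i ⟨x, hx⟩
    simpa using hx

end
end

section
/- Let S_1,…,S_n ⊆ ℝ be finite nonempty sets, and for i = 1,…,n let A_i = {s·e_i : s ∈ S_i} ⊆ ℝ^n be the copy of S_i placed on the i-th coordinate axis (e_i the i-th standard basis vector). Then E(A_1,…,A_n) = E(S_1)·E(S_2)⋯E(S_n). -/
open MeasureTheory ProbabilityTheory Pointwise
open scoped ENNReal RealInnerProductSpace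

noncomputable section

/-- `E(S)` for finite `S ⊆ ℝ`: the expected number of zeros `w ∈ ℝ` of
`F_{S,c}(w) = ∑_{s∈S} c(s)·e^{sw}` at which the derivative does not vanish,
for independent standard Gaussian coefficients. -/
def E1 (S : Finset ℝ) : ℝ≥0∞ :=
  ∫⁻ c : S → ℝ,
      (({w : ℝ | (∑ s : S, c s * Real.exp ((s : ℝ) * w)) = 0 ∧
        deriv (fun w => ∑ s : S, c s * Real.exp ((s : ℝ) * w)) w ≠ 0}).encard : ℝ≥0∞)
    ∂(Measure.pi fun _ => gaussianReal 0 1)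

theorem HasDerivAt.exists_mul_neg {f : ℝ → ℝ} {d w ε : ℝ} (h : HasDerivAt f d w) (hd : d ≠ 0)
    (hw : f w = 0) (hε : 0 < ε) :
    ∃ a b, a < w ∧ w < b ∧ w - ε < a ∧ b < w + ε ∧ f a * f b < 0 := by
  have hslope : ∀ᶠ y in nhdsWithin w {w}ᶜ, 0 < slope f w y * d :=
    (hasDerivAt_iff_tendsto_slope.1 h |>.mul_const d).eventually
      (lt_mem_nhds (mul_self_pos.2 hd))
  obtain ⟨δ, hδ, H⟩ := Metric.mem_nhdsWithin_iff.1 hslope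
  have hval : ∀ y, y ≠ w → |y - w| < δ → 0 < (y - w) * (f y * d) := by
    intro y hy hyw
    have h1 : 0 < slope f w y * d := H ⟨by simpa [Real.dist_eq] using hyw, hy⟩
    have h2 : f y = (y - w) * slope f w y := by
      have := sub_smul_slope f w y
      simpa [hw] using this.symm
    rw [h2]
    have h3 : 0 < (y - w) ^ 2 := by
      have := sub_ne_zero.2 hy
      positivity
    nlinarith [mul_pos h3 h1]
  have hη : 0 < min δ ε / 2 := by positivity
  have h1 := min_le_left δ ε
  have h2 := min_le_right δ ε
  refine ⟨w - min δ ε / 2, w + min δ ε / 2, by linarith, by linarith, by linarith, by linarith, ?_⟩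
  have ha := hval (w - min δ ε / 2) (by linarith) (by rw [abs_lt]; constructor <;> linarith)
  have hb := hval (w + min δ ε / 2) (by linarith) (by rw [abs_lt]; constructor <;> linarith)
  have ha' : f (w - min δ ε / 2) * d < 0 := by nlinarith
  have hb' : 0 < f (w + min δ ε / 2) * d := by nlinarith
  have hd2 : 0 < d ^ 2 := by positivity
  nlinarith [mul_neg_of_neg_of_pos ha' hb']

section SimpleZeros

variable {X : Type*} [TopologicalSpace X] {f f' : X → ℝ → ℝ}

theorem eventually_exists_simple_zero (hf : ∀ c w, HasDerivAt (f c) (f' c w) w)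
    (hfc : ∀ w, Continuous fun c => f c w) (hf' : Continuous (Function.uncurry f'))
    {c₀ : X} {w₀ : ℝ} (h0 : f c₀ w₀ = 0) (h1 : f' c₀ w₀ ≠ 0) {U : Set ℝ} (hU : U ∈ nhds w₀) :
    ∀ᶠ c in nhds c₀, ∃ w ∈ U, f c w = 0 ∧ f' c w ≠ 0 := by
  have hne : ∀ᶠ p in nhds (c₀, w₀), Function.uncurry f' p ≠ 0 :=
    hf'.continuousAt.eventually_ne h1
  rw [nhds_prod_eq] at hne
  obtain ⟨P, hP, Q, hQ, hPQ⟩ := Filter.eventually_prod_iff.1 hne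
  obtain ⟨ε, hε, hball⟩ := Metric.mem_nhds_iff.1 (Filter.inter_mem hU hQ)
  obtain ⟨a, b, haw, hwb, ha, hb, hab⟩ := (hf c₀ w₀).exists_mul_neg h1 h0 hε
  have hsign : ∀ᶠ c in nhds c₀, f c a * f c b < 0 :=
    ((hfc a).mul (hfc b)).continuousAt.eventually (gt_mem_nhds hab)
  filter_upwards [hP, hsign] with c hc hneg
  have hcont : ContinuousOn (f c) (Set.uIcc a b) := fun w _ =>
    (hf c w).continuousAt.continuousWithinAt
  have hmem : (0 : ℝ) ∈ Set.uIcc (f c a) (f c b) := by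
    rw [Set.mem_uIcc]
    rcases mul_neg_iff.1 hneg with h | h
    · exact Or.inr ⟨h.2.le, h.1.le⟩
    · exact Or.inl ⟨h.1.le, h.2.le⟩
  obtain ⟨w, hw, hw0⟩ := intermediate_value_uIcc hcont hmem
  rw [Set.uIcc_of_le (haw.trans hwb).le] at hw
  have hwU := hball (show w ∈ Metric.ball w₀ ε by
    rw [Metric.mem_ball, Real.dist_eq, abs_lt]
    constructor <;> linarith [hw.1, hw.2])
  exact ⟨w, hwU.1, hw0, hPQ hc hwU.2⟩

theorem lowerSemicontinuous_encard_simple_zeros (hf : ∀ c w, HasDerivAt (f c) (f' c w) w)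
    (hfc : ∀ w, Continuous fun c => f c w) (hf' : Continuous (Function.uncurry f')) :
    LowerSemicontinuous fun c => (({w | f c w = 0 ∧ f' c w ≠ 0}.encard : ℕ∞) : ℝ≥0∞) := by
  intro c₀ y (hy : y < _)
  beta_reduce at hy
  obtain ⟨t, ht, hyt⟩ : ∃ t : Finset ℝ, (t : Set ℝ) ⊆ {w | f c₀ w = 0 ∧ f' c₀ w ≠ 0} ∧
      y < (t.card : ℝ≥0∞) := by
    by_cases hfin : {w | f c₀ w = 0 ∧ f' c₀ w ≠ 0}.Finite
    · refine ⟨hfin.toFinset, by simp, ?_⟩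
      rw [hfin.encard_eq_coe_toFinset_card] at hy
      simpa using hy
    · obtain ⟨n, hn⟩ := ENNReal.exists_nat_gt hy.ne_top
      obtain ⟨t, ht, hcard⟩ := Set.Infinite.exists_subset_card_eq hfin n
      exact ⟨t, ht, by rwa [hcard]⟩
  obtain ⟨U, hU, hdisj⟩ := t.finite_toSet.t2_separation
  have hall : ∀ᶠ c in nhds c₀, ∀ x ∈ t, ∃ w ∈ U x, f c w = 0 ∧ f' c w ≠ 0 :=
    (Filter.eventually_all_finset t).2 fun x hx =>
      eventually_exists_simple_zero hf hfc hf' (ht hx).1 (ht hx).2 ((hU x).2.mem_nhds (hU x).1)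
  filter_upwards [hall] with c hc
  refine hyt.trans_le ?_
  choose! g hgU hg using hc
  have hinj : Set.InjOn g (t : Set ℝ) := fun x hx x' hx' hxx' =>
    hdisj.elim hx hx' (Set.not_disjoint_iff.2 ⟨g x, hgU x hx, hxx' ▸ hgU x' hx'⟩)
  have hle := Set.encard_le_encard_of_injOn (f := g) (s := (t : Set ℝ))
    (t := {w | f c w = 0 ∧ f' c w ≠ 0}) (fun x hx => hg x hx) hinj
  rw [Set.encard_coe_eq_coe_finsetCard] at hle
  exact_mod_cast ENat.toENNReal_le.2 hle

end SimpleZeros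

theorem encard_univ_pi {ι : Type*} [Fintype ι] {α : ι → Type*} (s : ∀ i, Set (α i)) :
    (Set.univ.pi s).encard = ∏ i, (s i).encard := by
  have h : (Set.univ.pi s).encard = ENat.card (∀ i, s i) :=
    ENat.card_congr (Equiv.Set.univPi s)
  rw [h]
  simp only [Set.encard, ENat.card, Cardinal.mk_pi, Cardinal.prod_eq_of_fintype,
    Cardinal.toENat_lift, map_prod]

theorem lintegral_fintype_prod_eq_prod {ι : Type*} [Fintype ι] {Ω : ι → Type*}
    [∀ i, MeasurableSpace (Ω i)] (μ : ∀ i, Measure (Ω i)) [∀ i, IsProbabilityMeasure (μ i)]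
    {g : ∀ i, Ω i → ℝ≥0∞} (hg : ∀ i, Measurable (g i)) :
    ∫⁻ x, ∏ i, g i (x i) ∂(Measure.pi μ) = ∏ i, ∫⁻ x, g i x ∂(μ i) := by
  refine (lintegral_prod_eq_prod_lintegral_of_indepFun Finset.univ
    (fun i (x : ∀ i, Ω i) => g i (x i)) (iIndepFun_pi fun i => (hg i).aemeasurable)
    fun i => (hg i).comp (measurable_pi_apply i)).trans ?_
  exact Finset.prod_congr rfl fun i _ => (measurePreserving_eval μ i).lintegral_comp (hg i)

/-- The number of zeros of `∑ j, c j * exp (s j * w)` at which the derivative does not vanish. -/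
def expSumCount {ι : Type*} [Fintype ι] (s c : ι → ℝ) : ℕ∞ :=
  {w : ℝ | ∑ j, c j * Real.exp (s j * w) = 0 ∧
    ∑ j, c j * (s j * Real.exp (s j * w)) ≠ 0}.encard

section ExpSum

variable {ι κ : Type*} [Fintype ι] [Fintype κ]

theorem hasDerivAt_expSum (s c : ι → ℝ) (w : ℝ) :
    HasDerivAt (fun w => ∑ j, c j * Real.exp (s j * w))
      (∑ j, c j * (s j * Real.exp (s j * w))) w := by
  refine HasDerivAt.fun_sum fun j _ => ?_
  have h := ((hasDerivAt_id w).const_mul (s j)).exp.const_mul (c j)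
  simpa [mul_comm] using h

theorem measurable_expSumCount (s : ι → ℝ) :
    Measurable fun c => (expSumCount s c : ℝ≥0∞) := by
  refine (lowerSemicontinuous_encard_simple_zeros
    (f := fun (c : ι → ℝ) w => ∑ j, c j * Real.exp (s j * w))
    (f' := fun (c : ι → ℝ) w => ∑ j, c j * (s j * Real.exp (s j * w)))
    (hasDerivAt_expSum s) (fun w => by fun_prop) ?_).measurable
  simp only [Function.uncurry_def]
  fun_prop

theorem lintegral_expSumCount_comp_equiv (e : ι ≃ κ) (s : κ → ℝ) :
    ∫⁻ c, (expSumCount (s ∘ e) c : ℝ≥0∞) ∂(Measure.pi fun _ => gaussianReal 0 1) =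
      ∫⁻ c, (expSumCount s c : ℝ≥0∞) ∂(Measure.pi fun _ => gaussianReal 0 1) := by
  have hmp := measurePreserving_arrowCongr' (fun _ : κ => gaussianReal 0 1)
    (fun _ : ι => gaussianReal 0 1) e.symm (MeasurableEquiv.refl ℝ)
    (fun _ => MeasurePreserving.id _)
  rw [← hmp.lintegral_comp (measurable_expSumCount (s ∘ e))]
  refine lintegral_congr fun c => ?_
  have h : ∀ j, MeasurableEquiv.arrowCongr' e.symm (MeasurableEquiv.refl ℝ) c j = c (e j) :=
    fun _ => rfl
  have hsum : ∀ F : κ → ℝ, ∑ j, F (e j) = ∑ k, F k := e.sum_comp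
  simp only [expSumCount, h, Function.comp_apply]
  congr! 6 with w
  · exact hsum fun k => c k * Real.exp (s k * w)
  · exact hsum fun k => c k * (s k * Real.exp (s k * w))

theorem E1_eq_lintegral_expSumCount (S : Finset ℝ) :
    E1 S = ∫⁻ c : S → ℝ, (expSumCount (fun s : S => (s : ℝ)) c : ℝ≥0∞)
      ∂(Measure.pi fun _ => gaussianReal 0 1) := by
  simp only [E1, expSumCount, (hasDerivAt_expSum (fun s : S => (s : ℝ)) _ _).deriv]

end ExpSum

section Axes

variable {n : ℕ}

theorem bijective_pi_smul_proj_iff (d : Fin n → ℝ) :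
    Function.Bijective (ContinuousLinearMap.pi fun i =>
      d i • (EuclideanSpace.proj i : EuclideanSpace ℝ (Fin n) →L[ℝ] ℝ)) ↔ ∀ i, d i ≠ 0 := by
  constructor
  · intro h i hi
    obtain ⟨v, hv⟩ := h.2 fun _ => 1
    simpa [hi] using congrFun hv i
  · intro h
    refine ⟨fun v w hvw => ?_, fun y => ⟨WithLp.toLp 2 fun i => y i / d i, ?_⟩⟩
    · ext i
      simpa [h i] using congrFun hvw i
    · ext i
      simp [mul_div_cancel₀, h i]

theorem inner_eq_coord_mul_of_mem_image_axis [DecidableEq (EuclideanSpace ℝ (Fin n))]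
    {T : Finset ℝ} {i : Fin n} {a : EuclideanSpace ℝ (Fin n)}
    (ha : a ∈ T.image fun s => s • EuclideanSpace.single i (1 : ℝ))
    (w : EuclideanSpace ℝ (Fin n)) : ⟪a, w⟫ = a i * w i := by
  obtain ⟨s, -, rfl⟩ := Finset.mem_image.1 ha
  simp [real_inner_smul_left, EuclideanSpace.inner_single_left]

theorem encard_nondegZeros_eq_prod {A : Fin n → Finset (EuclideanSpace ℝ (Fin n))}
    (hA : ∀ i, ∀ a ∈ A i, ∀ w : EuclideanSpace ℝ (Fin n), ⟪a, w⟫ = a i * w i)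
    (c : ∀ i, A i → ℝ) :
    (nondegZeros A c).encard =
      ∏ i, expSumCount (fun a : A i => (a : EuclideanSpace ℝ (Fin n)) i) (c i) := by
  have hF : ∀ w i, sysF A c w i =
      ∑ a : A i, c i a * Real.exp ((a : EuclideanSpace ℝ (Fin n)) i * w i) := fun w i =>
    Finset.sum_congr rfl fun a _ => by rw [hA i a a.2]
  have hderiv : ∀ w, HasFDerivAt (sysF A c) (ContinuousLinearMap.pi fun i =>
      (∑ a : A i, c i a * ((a : EuclideanSpace ℝ (Fin n)) i *
        Real.exp ((a : EuclideanSpace ℝ (Fin n)) i * w i))) •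
        (EuclideanSpace.proj i : EuclideanSpace ℝ (Fin n) →L[ℝ] ℝ)) w := by
    intro w
    refine hasFDerivAt_pi.2 fun i => ?_
    have h := (hasDerivAt_expSum (fun a : A i => (a : EuclideanSpace ℝ (Fin n)) i) (c i)
      (w i)).comp_hasFDerivAt w (EuclideanSpace.proj (𝕜 := ℝ) i).hasFDerivAt
    exact h.congr_of_eventuallyEq (Filter.Eventually.of_forall fun v => hF v i)
  simp only [expSumCount]
  rw [← encard_univ_pi, ← (WithLp.ofLp_injective 2).encard_image]
  congr 1
  ext v
  constructor
  · rintro ⟨w, ⟨hw, hb⟩, rfl⟩ i -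
    rw [(hderiv w).fderiv, bijective_pi_smul_proj_iff] at hb
    exact ⟨(hF w i).symm.trans (congrFun hw i), hb i⟩
  · intro hv
    refine ⟨WithLp.toLp 2 v, ⟨funext fun i => (hF _ i).trans (hv i trivial).1, ?_⟩, rfl⟩
    rw [(hderiv _).fderiv, bijective_pi_smul_proj_iff]
    exact fun i => (hv i trivial).2

theorem EE_eq_prod_lintegral_expSumCount {A : Fin n → Finset (EuclideanSpace ℝ (Fin n))}
    (hA : ∀ i, ∀ a ∈ A i, ∀ w : EuclideanSpace ℝ (Fin n), ⟪a, w⟫ = a i * w i) :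
    EE A = ∏ i, ∫⁻ c : A i → ℝ,
      (expSumCount (fun a : A i => (a : EuclideanSpace ℝ (Fin n)) i) c : ℝ≥0∞)
        ∂(Measure.pi fun _ => gaussianReal 0 1) := by
  rw [EE, coeffMeasure, ← lintegral_fintype_prod_eq_prod _ fun i => measurable_expSumCount _]
  refine lintegral_congr fun c => ?_
  rw [encard_nondegZeros_eq_prod hA]
  exact map_prod ENat.toENNRealRingHom _ _

/-- The bijection `s ↦ s • e_i` from `T ⊆ ℝ` onto its copy on the `i`-th coordinate axis. -/
def axisEquiv [DecidableEq (EuclideanSpace ℝ (Fin n))] (T : Finset ℝ) (i : Fin n) :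
    T ≃ (T.image fun s => s • EuclideanSpace.single i (1 : ℝ) :
      Finset (EuclideanSpace ℝ (Fin n))) where
  toFun s := ⟨s.1 • EuclideanSpace.single i (1 : ℝ), Finset.mem_image_of_mem _ s.2⟩
  invFun a := ⟨a.1 i, by
    obtain ⟨s, hs, hsa⟩ := Finset.mem_image.1 a.2
    rw [← hsa]
    simpa using hs⟩
  left_inv s := by simp
  right_inv := by
    rintro ⟨a, ha⟩
    obtain ⟨s, hs, rfl⟩ := Finset.mem_image.1 ha
    simp

end Axes

open Classical in
/-- For supports placed on the coordinate axes, `A_i = {s·e_i : s ∈ S_i}`, the expectation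
factors: `E(A_1,…,A_n) = E(S_1)⋯E(S_n)`. -/
theorem EE_axes {n : ℕ} (S : Fin n → Finset ℝ) (hS : ∀ i, (S i).Nonempty) :
    EE (fun i => (S i).image fun s =>
        (s • EuclideanSpace.single i (1 : ℝ) : EuclideanSpace ℝ (Fin n))) =
      ∏ i, E1 (S i) := by
  rw [EE_eq_prod_lintegral_expSumCount fun i a ha => inner_eq_coord_mul_of_mem_image_axis ha]
  refine Finset.prod_congr rfl fun i _ => ?_
  rw [E1_eq_lintegral_expSumCount, ← lintegral_expSumCount_comp_equiv (axisEquiv (S i) i)]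
  congr! 4
  ext s
  simp [axisEquiv]

end
end

section
/- Let A_1,…,A_n ⊆ ℝ^n be finite nonempty sets with convex hulls P_1,…,P_n, and suppose the Minkowski sum P_1 + ⋯ + P_n has dimension strictly less than n (its affine span is a proper affine subspace of ℝ^n). Then for every choice of coefficients c_i : A_i → ℝ, every common zero w ∈ ℝ^n of the system F_{A_1,c_1}(w) = … = F_{A_n,c_n}(w) = 0 is degenerate (the Jacobian matrix of (F_{A_1,c_1},…,F_{A_n,c_n}) at w is singular); consequently E(A_1,…,A_n) = 0. -/
open MeasureTheory ProbabilityTheory Pointwise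
open scoped ENNReal RealInnerProductSpace

noncomputable section

/-- A proper affine span of the Minkowski sum has a nonzero normal vector, on which each of the
supports is constant. -/
theorem exists_ne_zero_inner_eq_of_affineSpan_sum_ne_top {ι E : Type*} [Fintype ι]
    [NormedAddCommGroup E] [InnerProductSpace ℝ E] [FiniteDimensional ℝ E]
    (A : ι → Finset E) (hA : ∀ i, (A i).Nonempty)
    (hdim : affineSpan ℝ (∑ i, convexHull ℝ (A i : Set E)) ≠ ⊤) :
    ∃ v : E, v ≠ 0 ∧ ∀ i, ∀ a ∈ A i, ∀ b ∈ A i, ⟪a, v⟫ = ⟪b, v⟫ := by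
  classical
  set S : Set E := ∑ i, convexHull ℝ (A i : Set E) with hS
  choose x hx using hA
  have mem_S (y : ι → E) (hy : ∀ i, y i ∈ A i) : ∑ i, y i ∈ S :=
    Set.finsetSum_mem_finsetSum _ _ _ fun i _ => subset_convexHull ℝ _ (hy i)
  have hne : (affineSpan ℝ S : Set E).Nonempty :=
    ⟨_, subset_affineSpan ℝ S (mem_S x hx)⟩
  have hdir : (affineSpan ℝ S).direction ≠ ⊤ := fun h =>
    hdim ((AffineSubspace.direction_eq_top_iff_of_nonempty hne).1 h)
  obtain ⟨v, hv, hv0⟩ := Submodule.exists_mem_ne_zero_of_ne_bot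
    (fun h => hdir ((Submodule.orthogonal_eq_bot_iff).1 h))
  refine ⟨v, hv0, fun i a ha b hb => ?_⟩
  have hmem (a : E) (ha : a ∈ A i) : ∑ j, Function.update x i a j ∈ affineSpan ℝ S := by
    refine subset_affineSpan ℝ S (mem_S _ fun j => ?_)
    obtain rfl | hj := eq_or_ne j i
    · simpa using ha
    · simpa [hj] using hx j
  have h := (Submodule.mem_orthogonal _ v).1 hv _
    (AffineSubspace.vsub_mem_direction (hmem a ha) (hmem b hb))
  simpa [Finset.sum_update_of_mem, inner_sub_left, sub_eq_zero] using h

/-- Translating along a vector on which the support is constant rescales `Fexp`. -/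
theorem Fexp_add_smul {n : ℕ} {A : Finset (EuclideanSpace ℝ (Fin n))} (c : A → ℝ)
    (w v : EuclideanSpace ℝ (Fin n)) {t : ℝ} (ht : ∀ a ∈ A, ⟪a, v⟫ = t) (s : ℝ) :
    Fexp A c (w + s • v) = Real.exp (s * t) * Fexp A c w := by
  simp only [Fexp, Finset.mul_sum]
  refine Finset.sum_congr rfl fun a _ => ?_
  rw [inner_add_right, real_inner_smul_right, ht a a.2, Real.exp_add]
  ring

theorem differentiable_sysF {n : ℕ} (A : Fin n → Finset (EuclideanSpace ℝ (Fin n)))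
    (c : ∀ i, A i → ℝ) : Differentiable ℝ (sysF A c) := by
  rw [differentiable_pi]
  intro i
  exact Differentiable.fun_sum fun a _ =>
    ((innerSL ℝ (a : EuclideanSpace ℝ (Fin n))).differentiable.exp).const_mul (c i a)

/-- If every support is constant on `v`, the derivative at a common zero vanishes on `v`. -/
theorem fderiv_sysF_apply_eq_zero {n : ℕ} {A : Fin n → Finset (EuclideanSpace ℝ (Fin n))}
    (hA : ∀ i, (A i).Nonempty) {c : ∀ i, A i → ℝ} {w v : EuclideanSpace ℝ (Fin n)}
    (hv : ∀ i, ∀ a ∈ A i, ∀ b ∈ A i, ⟪a, v⟫ = ⟪b, v⟫) (hw : sysF A c w = 0) :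
    fderiv ℝ (sysF A c) w v = 0 := by
  have hline (s : ℝ) : sysF A c (w + s • v) = 0 := by
    ext i
    obtain ⟨b, hb⟩ := hA i
    have hi : Fexp (A i) (c i) w = 0 := congrFun hw i
    simp [sysF, Fexp_add_smul (c i) w v (fun a ha => hv i a ha b hb), hi]
  rw [← (differentiable_sysF A c w).lineDeriv_eq_fderiv]
  simp [lineDeriv, hline]

/-- If the Minkowski sum of the Newton polytopes is lower-dimensional (its affine span is a
proper affine subspace of `ℝ^n`), then every common zero of the system is degenerate, and
consequently `E(A_1,…,A_n) = 0`. -/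
theorem EE_eq_zero_of_lower_dim {n : ℕ}
    (A : Fin n → Finset (EuclideanSpace ℝ (Fin n))) (hA : ∀ i, (A i).Nonempty)
    (hdim : affineSpan ℝ
      (∑ i, convexHull ℝ ((A i : Set (EuclideanSpace ℝ (Fin n))))) ≠ ⊤) :
    (∀ (c : ∀ i, A i → ℝ) (w : EuclideanSpace ℝ (Fin n)),
      sysF A c w = 0 → ¬ Function.Bijective (fderiv ℝ (sysF A c) w)) ∧
    EE A = 0 := by
  obtain ⟨v, hv0, hv⟩ := exists_ne_zero_inner_eq_of_affineSpan_sum_ne_top A hA hdim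
  have hdeg (c : ∀ i, A i → ℝ) (w : EuclideanSpace ℝ (Fin n)) (hw : sysF A c w = 0) :
      ¬ Function.Bijective (fderiv ℝ (sysF A c) w) := fun hbij =>
    hv0 (hbij.1 ((fderiv_sysF_apply_eq_zero hA hv hw).trans (map_zero _).symm))
  refine ⟨hdeg, ?_⟩
  have hempty (c : ∀ i, A i → ℝ) : nondegZeros A c = ∅ :=
    Set.eq_empty_of_forall_notMem fun w hw => hdeg c w hw.1 hw.2
  simp [EE, hempty]

end
end
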